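/- arXiv:math/9307204 — 8 statements merged into one kernel-verified Lean document; each statement's English description precedes it below -/
import Mathlib

section
/- Let F : ℕ → ℂ (with the convention F_{−1} = 0) satisfy the associated Heun recurrence with data (c,μ,P), and suppose the power series Σ_{n≥0} F_n wⁿ converges for every complex w with |w| < 1, with sum H(w). Then for every w with 0 < |w| < 1, H satisfies the associated Heun equation: w(1−w)(1−k²w)H''(w) + [(γ+2c)(1−w)(1−k²w) − δw(1−k²w) − εk²w(1−w)]H'(w) + [(α+c)(β+c)k²w + c(c+γ−1)(1−w)/w + s − δc]H(w) = c(c+γ−1)/w + μ. -/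
/-- The associated Heun recurrence with data `(c, μ, P)`, where `P = {α,β;γ,δ,ε;s}`:
`(λ_n + μ_n + γ_n − s − (α+c)(β+c)k² + k²δc) F_n = μ_{n+1} F_{n+1} + λ_{n−1} F_{n−1}`
for `n ≥ 0`, with `F_{−1} = 0`, `F_0 = 1`, where `λ_n = k²(n+c+α)(n+c+β)`,
`μ_n = (n+c)(n+c+γ−1) + μδ_{n,0}`, `γ_n = (1−k²)δ(n+c)`. -/
def AssocHeunRec (k α β γ δ ε s c μ : ℂ) (F : ℕ → ℂ) : Prop :=
  F 0 = 1 ∧ ∀ n : ℕ,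
    (k ^ 2 * ((n : ℂ) + c + α) * ((n : ℂ) + c + β)
        + ((n : ℂ) + c) * ((n : ℂ) + c + γ - 1) + (if n = 0 then μ else 0)
        + (1 - k ^ 2) * δ * ((n : ℂ) + c)
        - s - (α + c) * (β + c) * k ^ 2 + k ^ 2 * δ * c) * F n
      = (((n : ℂ) + 1) + c) * (((n : ℂ) + 1) + c + γ - 1) * F (n + 1)
        + (if n = 0 then 0 else
            k ^ 2 * (((n : ℂ) - 1) + c + α) * (((n : ℂ) - 1) + c + β) * F (n - 1))

/-- Replace the terms and the value of a convergent complex series by equal ones. -/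
lemma hasSum_transfer {f g : ℕ → ℂ} {a b : ℂ} (h : HasSum f a) (hf : ∀ n, g n = f n)
    (hb : b = a) : HasSum g b := by
  have e : g = f := funext hf
  rw [e, hb]
  exact h

open scoped NNReal ENNReal in
/-- Termwise differentiation of a power series convergent on the open unit disk. -/
lemma powerSeries_deriv_hasSum (F : ℕ → ℂ) (H : ℂ → ℂ)
    (hH : ∀ w : ℂ, ‖w‖ < 1 → HasSum (fun n : ℕ => F n * w ^ n) (H w)) :
    ∀ w : ℂ, ‖w‖ < 1 →
      HasSum (fun n : ℕ => (((n : ℂ) + 1) * F (n + 1)) * w ^ n) (deriv H w) := by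
  have hp : HasFPowerSeriesOnBall H (FormalMultilinearSeries.ofScalars ℂ F) 0 1 := by
    refine ⟨?_, one_pos, ?_⟩
    · refine ENNReal.le_of_forall_nnreal_lt fun r hr => ?_
      have hr1 : (r : ℝ) < 1 := by exact_mod_cast hr
      apply FormalMultilinearSeries.le_radius_of_summable_norm
      have h := (hH ((r : ℝ) : ℂ) (by simpa using hr1)).summable.norm
      simpa [FormalMultilinearSeries.ofScalars_norm] using h
    · intro y hy
      have hy1 : ‖y‖ < 1 := by
        rw [Metric.mem_eball, edist_zero_right, enorm_eq_nnnorm] at hy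
        exact_mod_cast hy
      simpa [FormalMultilinearSeries.ofScalars_apply_eq, mul_comm] using hH y hy1
  intro w hw
  have hw' : w ∈ Metric.eball (0 : ℂ) 1 := by
    rw [Metric.mem_eball, edist_zero_right, enorm_eq_nnnorm]
    exact_mod_cast hw
  have h := hp.fderiv.hasSum hw'
  have h1 := (ContinuousLinearMap.apply ℂ ℂ (1 : ℂ)).hasSum h
  rw [zero_add] at h1
  have e1 : (ContinuousLinearMap.apply ℂ ℂ (1 : ℂ)) (fderiv ℂ H w) = deriv H w := by simp
  rw [e1] at h1
  refine hasSum_transfer h1 ?_ rfl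
  · intro n
    have e := FormalMultilinearSeries.derivSeries_coeff_one
      (FormalMultilinearSeries.ofScalars ℂ F) n
    rw [FormalMultilinearSeries.coeff_ofScalars] at e
    simp only [Function.comp_apply, ContinuousLinearMap.apply_apply,
      FormalMultilinearSeries.apply_eq_pow_smul_coeff, _root_.smul_apply, e]
    simp
    ring

/-- If `F` satisfies the associated Heun recurrence with data `(c,μ,P)` and
`H(w) = Σ F_n wⁿ` on the open unit disk, then `H` satisfies the (inhomogeneous)
associated Heun differential equation on the punctured open unit disk. -/
theorem assoc_heun_generating_function_satisfies_assoc_heun_ode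
    (k : ℝ) (hk0 : 0 < k ^ 2) (hk1 : k ^ 2 < 1)
    (α β γ δ ε s c μ : ℂ) (hP : α + β = γ + δ + ε - 1)
    (F : ℕ → ℂ) (hF : AssocHeunRec (k : ℂ) α β γ δ ε s c μ F)
    (H : ℂ → ℂ) (hH : ∀ w : ℂ, ‖w‖ < 1 → HasSum (fun n : ℕ => F n * w ^ n) (H w)) :
    ∀ w : ℂ, 0 < ‖w‖ → ‖w‖ < 1 →
      w * (1 - w) * (1 - (k : ℂ) ^ 2 * w) * deriv (deriv H) w
        + ((γ + 2 * c) * (1 - w) * (1 - (k : ℂ) ^ 2 * w) - δ * w * (1 - (k : ℂ) ^ 2 * w)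
            - ε * (k : ℂ) ^ 2 * w * (1 - w)) * deriv H w
        + ((α + c) * (β + c) * (k : ℂ) ^ 2 * w + c * (c + γ - 1) * (1 - w) / w
            + s - δ * c) * H w
      = c * (c + γ - 1) / w + μ := by
  intro w hw0 hw1
  have hw : w ≠ 0 := norm_pos_iff.mp hw0
  obtain ⟨hF0, hrec⟩ := hF
  have S0 := hH w hw1
  have hD := powerSeries_deriv_hasSum F H hH
  have D1 := hD w hw1
  have D2 := powerSeries_deriv_hasSum _ _ hD w hw1
  have S1 : HasSum (fun n : ℕ => (n : ℂ) * (F n * w ^ n)) (w * deriv H w) := by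
    rw [← hasSum_nat_add_iff' 1]
    refine hasSum_transfer (D1.mul_left w) ?_ ?_
    · intro n
      push_cast
      ring
    · simp
  have S2 : HasSum (fun n : ℕ => (n : ℂ) * ((n : ℂ) - 1) * (F n * w ^ n))
      (w ^ 2 * deriv (deriv H) w) := by
    rw [← hasSum_nat_add_iff' 2]
    refine hasSum_transfer (D2.mul_left (w ^ 2)) ?_ ?_
    · intro n
      push_cast
      ring
    · simp [Finset.sum_range_succ]
  have T0 : HasSum (fun n : ℕ => ((n : ℂ) + c) * ((n : ℂ) + c + γ - 1) * (F n * w ^ n))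
      (w ^ 2 * deriv (deriv H) w + (2 * c + γ) * (w * deriv H w) + c * (c + γ - 1) * H w) := by
    refine hasSum_transfer ((S2.add (S1.mul_left (2 * c + γ))).add (S0.mul_left (c * (c + γ - 1)))) ?_ rfl
    intro n
    ring
  have T2 : HasSum (fun n : ℕ => w ^ 2 * ((k : ℂ) ^ 2 * ((n : ℂ) + c + α) * ((n : ℂ) + c + β)
        * (F n * w ^ n)))
      (w ^ 2 * ((k : ℂ) ^ 2 * (w ^ 2 * deriv (deriv H) w + (2 * c + α + β + 1) * (w * deriv H w)
        + (α + c) * (β + c) * H w))) := by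
    refine hasSum_transfer ((((S2.add (S1.mul_left (2 * c + α + β + 1))).add
      (S0.mul_left ((α + c) * (β + c)))).mul_left ((k : ℂ) ^ 2)).mul_left (w ^ 2)) ?_ rfl
    intro n
    ring
  have T1 : HasSum (fun n : ℕ => w * (((k : ℂ) ^ 2 * ((n : ℂ) + c + α) * ((n : ℂ) + c + β)
        + ((n : ℂ) + c) * ((n : ℂ) + c + γ - 1)
        + (1 - (k : ℂ) ^ 2) * δ * ((n : ℂ) + c)
        - s - (α + c) * (β + c) * (k : ℂ) ^ 2 + (k : ℂ) ^ 2 * δ * c) * (F n * w ^ n)))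
      (w * (((k : ℂ) ^ 2 + 1) * (w ^ 2 * deriv (deriv H) w)
        + ((k : ℂ) ^ 2 * (2 * c + α + β + 1) + (2 * c + γ) + (1 - (k : ℂ) ^ 2) * δ)
          * (w * deriv H w)
        + (c * (c + γ - 1) + δ * c - s) * H w)) := by
    refine hasSum_transfer ((((S2.mul_left ((k : ℂ) ^ 2 + 1)).add (S1.mul_left
      ((k : ℂ) ^ 2 * (2 * c + α + β + 1) + (2 * c + γ) + (1 - (k : ℂ) ^ 2) * δ))).add
      (S0.mul_left (c * (c + γ - 1) + δ * c - s))).mul_left w) ?_ rfl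
    intro n
    ring
  have T0' := (hasSum_nat_add_iff' 1).mpr ((hasSum_nat_add_iff' 1).mpr T0)
  have T1' := (hasSum_nat_add_iff' 1).mpr T1
  have hz := (T0'.sub T1').add T2
  have hzero := hz.unique (by
    refine hasSum_transfer (hasSum_zero : HasSum (fun _ : ℕ => (0 : ℂ)) 0) ?_ rfl
    intro n
    have h := hrec (n + 1)
    simp only [Nat.add_eq_zero_iff, one_ne_zero, and_false, if_false, Nat.add_sub_cancel] at h
    push_cast at h ⊢
    linear_combination (-w ^ (n + 2)) * h)
  have h0 := hrec 0
  simp only [if_true, Nat.cast_zero, zero_add, hF0] at h0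
  simp only [Finset.range_one, Finset.sum_singleton, Nat.cast_zero, Nat.cast_one, zero_add,
    pow_zero, pow_one, hF0] at hzero
  have hε : ε = α + β + 1 - γ - δ := by linear_combination -hP
  subst hε
  field_simp
  linear_combination hzero - w * h0
end

section
/- Let P = {α,β;γ,δ,ε;s} be Heun parameters with modulus k, c an association parameter and μ a co-recursivity parameter, and assume that for every integer n ≥ 1 one has (n+c)(n+c+γ−1) ≠ 0 and (n+c)(n+c+α−1) ≠ 0. Let A : ℕ → ℂ satisfy the associated Heun recurrence with data (c,μ,P), and let B : ℕ → ℂ satisfy the associated Heun recurrence with data (c,μ,P'_α), where P'_α = {γ, β; α, δ+γ−α, ε+γ−α; s}. Then for every n ∈ ℕ, (c+γ)_n A_n = (c+α)_n B_n, where (x)_n = x(x+1)⋯(x+n−1) is the Pochhammer symbol. -/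
/-- The Pochhammer symbol `(x)_n = x(x+1)⋯(x+n−1)`. -/
noncomputable def poch (x : ℂ) (n : ℕ) : ℂ := ∏ i ∈ Finset.range n, (x + (i : ℂ))

theorem poch_succ' (x : ℂ) (n : ℕ) : poch x (n + 1) = poch x n * (x + (n : ℂ)) := by
  simp [poch, Finset.prod_range_succ]

/-- Connection between associated Heun coefficient sequences under the parameter map
`P'_α = {γ, β; α, δ+γ−α, ε+γ−α; s}`: `(c+γ)_n A_n = (c+α)_n B_n`. -/
theorem assocHeun_connection_P'_alpha
    (k : ℝ) (hk0 : 0 < k ^ 2) (hk1 : k ^ 2 < 1)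
    (α β γ δ ε s c μ : ℂ) (hP : α + β = γ + δ + ε - 1)
    (hγ : ∀ n : ℕ, 1 ≤ n → ((n : ℂ) + c) * ((n : ℂ) + c + γ - 1) ≠ 0)
    (hα : ∀ n : ℕ, 1 ≤ n → ((n : ℂ) + c) * ((n : ℂ) + c + α - 1) ≠ 0)
    (A B : ℕ → ℂ)
    (hA : AssocHeunRec (k : ℂ) α β γ δ ε s c μ A)
    (hB : AssocHeunRec (k : ℂ) γ β α (δ + γ - α) (ε + γ - α) s c μ B) :
    ∀ n : ℕ, poch (c + γ) n * A n = poch (c + α) n * B n := by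
  obtain ⟨hA0, hA⟩ := hA
  obtain ⟨hB0, hB⟩ := hB
  have key : ∀ n : ℕ, poch (c + γ) n * A n = poch (c + α) n * B n ∧
      poch (c + γ) (n + 1) * A (n + 1) = poch (c + α) (n + 1) * B (n + 1) := by
    intro n
    induction n with
    | zero =>
      refine ⟨by simp [poch, hA0, hB0], ?_⟩
      have h1 := hA 0
      have h2 := hB 0
      have hne := left_ne_zero_of_mul (hγ 1 le_rfl)
      simp only [if_true, hA0, hB0, Nat.cast_zero, zero_add, Nat.cast_one] at h1 h2 hne ⊢
      apply mul_left_cancel₀ hne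
      simp only [poch, Finset.prod_range_one, Nat.cast_zero]
      linear_combination h2 - h1
    | succ m ih =>
      obtain ⟨ih1, ih2⟩ := ih
      refine ⟨ih2, ?_⟩
      have h1 := hA (m + 1)
      have h2 := hB (m + 1)
      have hne := left_ne_zero_of_mul (hγ (m + 2) (by omega))
      rw [if_neg (by omega), if_neg (by omega)] at h1 h2
      simp only [Nat.add_sub_cancel] at h1 h2
      push_cast at h1 h2 hne
      apply mul_left_cancel₀ hne
      rw [poch_succ' _ (m + 1), poch_succ' _ (m + 1)]
      rw [poch_succ', poch_succ'] at ih2 ⊢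
      push_cast
      linear_combination poch (c + α) m * (c + α + m) * h2 - poch (c + γ) m * (c + γ + m) * h1
        + ((k : ℂ) ^ 2 * ((m : ℂ) + 1 + c + α) * ((m : ℂ) + 1 + c + β)
          + ((m : ℂ) + 1 + c) * ((m : ℂ) + 1 + c + γ - 1)
          + (1 - (k : ℂ) ^ 2) * δ * ((m : ℂ) + 1 + c)
          - s - (α + c) * (β + c) * (k : ℂ) ^ 2 + (k : ℂ) ^ 2 * δ * c) * ih2
        - (k : ℂ) ^ 2 * ((m : ℂ) + c + α) * ((m : ℂ) + c + β) * ((m : ℂ) + c + γ) * ih1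
  exact fun n => (key n).1
end

section
/- Let P = {α,β;γ,δ,ε;s} be Heun parameters with modulus k, c an association parameter and μ a co-recursivity parameter, and assume that for every integer n ≥ 1 one has (n+c)(n+c+γ−1) ≠ 0 and (n+c)(n+c+β−1) ≠ 0. Let A : ℕ → ℂ satisfy the associated Heun recurrence with data (c,μ,P), and let B : ℕ → ℂ satisfy the associated Heun recurrence with data (c,μ,P'_β), where P'_β = {α, γ; β, δ+γ−β, ε+γ−β; s}. Then for every n ∈ ℕ, (c+γ)_n A_n = (c+β)_n B_n, where (x)_n = x(x+1)⋯(x+n−1) is the Pochhammer symbol. -/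
/-- Connection between associated Heun coefficient sequences under the parameter map
`P'_β = {α, γ; β, δ+γ−β, ε+γ−β; s}`: `(c+γ)_n A_n = (c+β)_n B_n`. -/
theorem assocHeun_connection_P'_beta
    (k : ℝ) (hk0 : 0 < k ^ 2) (hk1 : k ^ 2 < 1)
    (α β γ δ ε s c μ : ℂ) (hP : α + β = γ + δ + ε - 1)
    (hγ : ∀ n : ℕ, 1 ≤ n → ((n : ℂ) + c) * ((n : ℂ) + c + γ - 1) ≠ 0)
    (hβ : ∀ n : ℕ, 1 ≤ n → ((n : ℂ) + c) * ((n : ℂ) + c + β - 1) ≠ 0)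
    (A B : ℕ → ℂ)
    (hA : AssocHeunRec (k : ℂ) α β γ δ ε s c μ A)
    (hB : AssocHeunRec (k : ℂ) α γ β (δ + γ - β) (ε + γ - β) s c μ B) :
    ∀ n : ℕ, poch (c + γ) n * A n = poch (c + β) n * B n := by
  obtain ⟨hA0, hA⟩ := hA
  obtain ⟨hB0, hB⟩ := hB
  have hs : ∀ (x : ℂ) (n : ℕ), poch x (n + 1) = poch x n * (x + n) := by
    intro x n
    simp [poch, Finset.prod_range_succ]
  have hc : ∀ n : ℕ, (n : ℂ) + 1 + c ≠ 0 := by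
    intro n
    have h := left_ne_zero_of_mul (hγ (n + 1) (by omega))
    push_cast at h
    exact h
  have key : ∀ n : ℕ, poch (c + γ) n * A n = poch (c + β) n * B n ∧
      poch (c + γ) (n + 1) * A (n + 1) = poch (c + β) (n + 1) * B (n + 1) := by
    intro n
    induction n with
    | zero =>
      refine ⟨by simp [poch, hA0, hB0], ?_⟩
      have h1 := hA 0
      have h2 := hB 0
      have h3 := hc 0
      simp only [if_true, hA0, hB0, Nat.cast_zero, zero_add] at h1 h2 h3
      simp only [poch, zero_add, Finset.prod_range_one, Nat.cast_zero, add_zero]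
      apply mul_left_cancel₀ h3
      linear_combination h2 - h1
    | succ n ih =>
      obtain ⟨ih0, ih1⟩ := ih
      refine ⟨ih1, ?_⟩
      have h1 := hA (n + 1)
      have h2 := hB (n + 1)
      have h3 := hc (n + 1)
      simp only [Nat.add_eq_zero_iff, one_ne_zero, and_false, if_false, Nat.add_sub_cancel,
        Nat.cast_add, Nat.cast_one] at h1 h2 h3
      rw [hs _ (n + 1), hs _ (n + 1)]
      have eγ := hs (c + γ) n
      have eβ := hs (c + β) n
      generalize poch (c + γ) (n + 1) = p1 at *
      generalize poch (c + β) (n + 1) = q1 at *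
      push_cast
      apply mul_left_cancel₀ h3
      linear_combination q1 * h2 - p1 * h1
        + ((k : ℂ) ^ 2 * ((n : ℂ) + 1 + c + α) * ((n : ℂ) + 1 + c + β)
          + ((n : ℂ) + 1 + c) * ((n : ℂ) + 1 + c + γ - 1)
          + (1 - (k : ℂ) ^ 2) * δ * ((n : ℂ) + 1 + c)
          - s - (α + c) * (β + c) * (k : ℂ) ^ 2 + (k : ℂ) ^ 2 * δ * c) * ih1
        - (k : ℂ) ^ 2 * ((n : ℂ) + c + α) * ((n : ℂ) + c + β) * ((n : ℂ) + c + γ) * ih0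
        - (k : ℂ) ^ 2 * ((n : ℂ) + c + α) * ((n : ℂ) + c + β) * A n * eγ
        + (k : ℂ) ^ 2 * ((n : ℂ) + c + α) * ((n : ℂ) + c + γ) * B n * eβ
  exact fun n => (key n).1
end

section
/- Let P = {α,β;γ,δ,ε;s} be Heun parameters with modulus k, c an association parameter and μ a co-recursivity parameter. Assume Re γ > Re α > −Re c, and that for every integer n ≥ 1, (n+c)(n+c+γ−1) ≠ 0 and (n+c)(n+c+α−1) ≠ 0. Let A satisfy the associated Heun recurrence with data (c,μ,P) and B satisfy the associated Heun recurrence with data (c,μ,P'_α), where P'_α = {γ, β; α, δ+γ−α, ε+γ−α; s}. Suppose the power series Hn(c,μ,P;w) = Σ_{n≥0} A_n wⁿ and Hn(c,μ,P'_α;w) = Σ_{n≥0} B_n wⁿ both converge for every complex w with |w| < 1. Then for every w with |w| < 1: Hn(c,μ,P;w) = (1/B(γ−α, α+c)) ∫₀¹ t^{c+α−1} (1−t)^{γ−α−1} Hn(c,μ,P'_α; wt) dt, where B(x,y) is the Beta function and the complex powers of t ∈ (0,1) and 1−t are the principal ones. -/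
theorem betaIntegral_step (u v : ℂ) (hu : 0 < u.re) (hv : 0 < v.re) :
    (u + v) * Complex.betaIntegral u (v + 1) = v * Complex.betaIntegral u v := by
  have h1 := Complex.Gamma_mul_Gamma_eq_betaIntegral hu hv
  have h2 := Complex.Gamma_mul_Gamma_eq_betaIntegral (s := u) (t := v + 1) hu
    (by simp; linarith)
  have huv : 0 < (u + v).re := by simp; linarith
  have hv0 : v ≠ 0 := by rintro rfl; simp at hv
  have huv0 : u + v ≠ 0 := by intro h; rw [h] at huv; simp at huv
  rw [Complex.Gamma_add_one v hv0, ← add_assoc, Complex.Gamma_add_one _ huv0] at h2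
  have hG := Complex.Gamma_ne_zero_of_re_pos huv
  apply mul_left_cancel₀ hG
  linear_combination v * h1 - h2

theorem betaIntegral_ne_zero_aux (u v : ℂ) (hu : 0 < u.re) (hv : 0 < v.re) :
    Complex.betaIntegral u v ≠ 0 := by
  have h1 := Complex.Gamma_mul_Gamma_eq_betaIntegral hu hv
  intro h
  rw [h, mul_zero] at h1
  exact mul_ne_zero (Complex.Gamma_ne_zero_of_re_pos hu) (Complex.Gamma_ne_zero_of_re_pos hv) h1

theorem assocHeun_coeff (k α β γ δ ε ε' s c μ : ℂ)
    (hγ : ∀ n : ℕ, 1 ≤ n → ((n : ℂ) + c) * ((n : ℂ) + c + γ - 1) ≠ 0)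
    (A B b : ℕ → ℂ) (b0 : b 0 ≠ 0)
    (hb : ∀ n : ℕ, (γ + c + n) * b (n + 1) = (α + c + n) * b n)
    (hA : AssocHeunRec k α β γ δ ε s c μ A)
    (hB : AssocHeunRec k γ β α (δ + γ - α) ε' s c μ B) (n : ℕ) :
    b 0 * A n = b n * B n := by
  induction n using Nat.strong_induction_on with
  | _ n ih =>
    rcases n with _ | n
    · rw [hA.1, hB.1]
    · have hA' := hA.2 n
      have hB' := hB.2 n
      have h0 := hγ (n + 1) (by omega)
      have i1 := ih n (by omega)
      have e1 := hb n
      push_cast at h0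
      apply mul_left_cancel₀ h0
      rcases n with _ | m
      · simp at hA' hB' e1
        push_cast
        simp only [zero_add]
        linear_combination (-b 0) * hA' + b 0 * hB' + (1 + c) * B 1 * (-e1) +
          (k ^ 2 * (c + α) * (c + β) + c * (c + γ - 1) + μ + (1 - k ^ 2) * δ * c - s
            - (α + c) * (β + c) * k ^ 2 + k ^ 2 * δ * c) * i1
      · have i2 := ih m (by omega)
        have e2 := hb m
        simp at hA' hB' i1 e1 e2
        push_cast
        linear_combination (-b 0) * hA' + b (m+1) * hB' + (m + 1 + 1 + c) * B (m+2) * (-e1) +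
          (k ^ 2 * (m + 1 + c + α) * (m + 1 + c + β) + (m + 1 + c) * (m + 1 + c + γ - 1)
            + (1 - k ^ 2) * δ * (m + 1 + c) - s
            - (α + c) * (β + c) * k ^ 2 + k ^ 2 * δ * c) * i1
          - k ^ 2 * (m + c + α) * (m + c + β) * i2 + k ^ 2 * (m + c + β) * B m * e2

/-- The integral transform `Hn(c,μ,P;w) =
(1/B(γ−α,α+c)) ∫₀¹ t^{c+α−1} (1−t)^{γ−α−1} Hn(c,μ,P'_α;wt) dt` on the unit disk,
where `P'_α = {γ, β; α, δ+γ−α, ε+γ−α; s}`. -/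
theorem assocHeun_integral_transform_P'_alpha
    (k : ℝ) (hk0 : 0 < k ^ 2) (hk1 : k ^ 2 < 1)
    (α β γ δ ε s c μ : ℂ) (hP : α + β = γ + δ + ε - 1)
    (hre : γ.re > α.re ∧ α.re > -c.re)
    (hγ : ∀ n : ℕ, 1 ≤ n → ((n : ℂ) + c) * ((n : ℂ) + c + γ - 1) ≠ 0)
    (hα : ∀ n : ℕ, 1 ≤ n → ((n : ℂ) + c) * ((n : ℂ) + c + α - 1) ≠ 0)
    (A B : ℕ → ℂ)
    (hA : AssocHeunRec (k : ℂ) α β γ δ ε s c μ A)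
    (hB : AssocHeunRec (k : ℂ) γ β α (δ + γ - α) (ε + γ - α) s c μ B)
    (HA HB : ℂ → ℂ)
    (hHA : ∀ w : ℂ, ‖w‖ < 1 → HasSum (fun n : ℕ => A n * w ^ n) (HA w))
    (hHB : ∀ w : ℂ, ‖w‖ < 1 → HasSum (fun n : ℕ => B n * w ^ n) (HB w)) :
    ∀ w : ℂ, ‖w‖ < 1 →
      HA w = (1 / Complex.betaIntegral (γ - α) (α + c)) *
        ∫ t in (0 : ℝ)..1,
          (t : ℂ) ^ (c + α - 1) * (1 - (t : ℂ)) ^ (γ - α - 1) * HB (w * t) := by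
  intro w hw
  obtain ⟨h1, h2⟩ := hre
  have hu : 0 < (γ - α).re := by simp; linarith
  have hv : 0 < (α + c).re := by simp; linarith
  have hvn : ∀ n : ℕ, 0 < (α + c + n).re := by
    intro n
    have : (0 : ℝ) ≤ n := Nat.cast_nonneg n
    simp at hv ⊢; linarith
  have hcoef := assocHeun_coeff (k : ℂ) α β γ δ ε (ε + γ - α) s c μ hγ A B
    (fun n => Complex.betaIntegral (γ - α) (α + c + n))
    (betaIntegral_ne_zero_aux _ _ hu (hvn 0))
    (fun n => by
      have := betaIntegral_step (γ - α) (α + c + n) hu (hvn n)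
      push_cast
      rw [← this, add_assoc (α + c)]; ring) hA hB
  have hb0 := betaIntegral_ne_zero_aux _ _ hu hv
  set K : ℝ → ℂ := fun t => (t : ℂ) ^ (c + α - 1) * (1 - (t : ℂ)) ^ (γ - α - 1) with hK
  have hKint : IntervalIntegrable K MeasureTheory.volume 0 1 := by
    have := Complex.betaIntegral_convergent (u := c + α) (v := γ - α) (by rwa [add_comm]) hu
    exact this
  have hterm : ∀ n : ℕ, ∫ t in (0 : ℝ)..1, K t * (B n * (w * t) ^ n)
      = Complex.betaIntegral (γ - α) (α + c) * (A n * w ^ n) := by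
    intro n
    have e := hcoef n
    simp only [Nat.cast_zero, add_zero] at e
    rw [← mul_assoc, e, Complex.betaIntegral_symm, Complex.betaIntegral, mul_assoc,
      ← intervalIntegral.integral_mul_const]
    apply intervalIntegral.integral_congr_ae
    filter_upwards with t ht
    rw [Set.uIoc_of_le zero_le_one] at ht
    have ht0 : (t : ℂ) ≠ 0 := by exact_mod_cast ht.1.ne'
    have : α + c + n - 1 = (c + α - 1) + n := by ring
    rw [this, Complex.cpow_add _ _ ht0, Complex.cpow_natCast, hK]
    ring
  have hsum : HasSum (fun n : ℕ => ∫ t in (0 : ℝ)..1, K t * (B n * (w * t) ^ n))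
      (∫ t in (0 : ℝ)..1, K t * HB (w * t)) := by
    have hs : Summable (fun n : ℕ => ‖B n * w ^ n‖) := (hHB w hw).summable.norm
    apply intervalIntegral.hasSum_integral_of_dominated_convergence
      (fun n t => ‖K t‖ * ‖B n * w ^ n‖)
    · intro n
      have := (intervalIntegrable_iff.mp hKint).aestronglyMeasurable
      exact this.mul (by fun_prop : Continuous fun t : ℝ => B n * (w * t) ^ n).aestronglyMeasurable
    · intro n
      filter_upwards with t ht
      rw [Set.uIoc_of_le zero_le_one] at ht
      rw [norm_mul]
      gcongr
      rw [norm_mul, norm_mul, norm_pow, norm_pow, norm_mul, Complex.norm_real, Real.norm_eq_abs,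
        abs_of_pos ht.1]
      gcongr
      · exact mul_nonneg (norm_nonneg _) ht.1.le
      exact mul_le_of_le_one_right (norm_nonneg _) ht.2
    · filter_upwards with t ht
      exact hs.mul_left _
    · simp_rw [tsum_mul_left]
      exact hKint.norm.mul_const _
    · filter_upwards with t ht
      rw [Set.uIoc_of_le zero_le_one] at ht
      apply (hHB (w * t) _).mul_left
      rw [norm_mul, Complex.norm_real, Real.norm_eq_abs, abs_of_pos ht.1]
      exact lt_of_le_of_lt (mul_le_of_le_one_right (norm_nonneg _) ht.2) hw
  simp_rw [hterm] at hsum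
  have := hsum.unique ((hHA w hw).mul_left _)
  rw [this, one_div, inv_mul_cancel_left₀ hb0]
end

section
/- Let P = {α,β;γ,δ,ε;s} be Heun parameters with modulus k, c an association parameter and μ a co-recursivity parameter, and assume that for every integer n ≥ 1 one has n+c ≠ 0, n+c+γ−1 ≠ 0 and n+c+α−1 ≠ 0. Let A : ℕ → ℂ satisfy the associated Heun recurrence with data (c,μ,P), and let B : ℕ → ℂ satisfy the associated Heun recurrence with data (c+α−1, μ, P''_α), where P''_α = {2−α, β+1−α; γ+1−α, δ+1−α, ε+1−α; s+(α−1)(γ+δ−α)}. Then for every n ∈ ℕ, (c+1)_n A_n = (c+α)_n B_n, where (x)_n = x(x+1)⋯(x+n−1) is the Pochhammer symbol. -/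
/-- Connection between associated Heun coefficient sequences under the parameter map
`P''_α = {2−α, β+1−α; γ+1−α, δ+1−α, ε+1−α; s+(α−1)(γ+δ−α)}` with association parameter
shifted to `c+α−1`: `(c+1)_n A_n = (c+α)_n B_n`. -/
theorem assocHeun_connection_P''_alpha
    (k : ℝ) (hk0 : 0 < k ^ 2) (hk1 : k ^ 2 < 1)
    (α β γ δ ε s c μ : ℂ) (hP : α + β = γ + δ + ε - 1)
    (hc : ∀ n : ℕ, 1 ≤ n → (n : ℂ) + c ≠ 0)
    (hγ : ∀ n : ℕ, 1 ≤ n → (n : ℂ) + c + γ - 1 ≠ 0)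
    (hα : ∀ n : ℕ, 1 ≤ n → (n : ℂ) + c + α - 1 ≠ 0)
    (A B : ℕ → ℂ)
    (hA : AssocHeunRec (k : ℂ) α β γ δ ε s c μ A)
    (hB : AssocHeunRec (k : ℂ) (2 - α) (β + 1 - α) (γ + 1 - α) (δ + 1 - α) (ε + 1 - α)
      (s + (α - 1) * (γ + δ - α)) (c + α - 1) μ B) :
    ∀ n : ℕ, poch (c + 1) n * A n = poch (c + α) n * B n := by
  obtain ⟨hA0, hA⟩ := hA
  obtain ⟨hB0, hB⟩ := hB
  have hp : ∀ (x : ℂ) (n : ℕ), poch x (n + 1) = poch x n * (x + (n : ℂ)) := by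
    intro x n
    simp only [poch, Finset.prod_range_succ]
  have hz : ∀ x : ℂ, poch x 0 = 1 := by
    intro x
    simp [poch]
  have key : ∀ n : ℕ, poch (c + 1) n * A n = poch (c + α) n * B n ∧
      poch (c + 1) (n + 1) * A (n + 1) = poch (c + α) (n + 1) * B (n + 1) := by
    intro n
    induction n with
    | zero =>
      refine ⟨by rw [hz, hz, hA0, hB0], ?_⟩
      have h1 := hA 0
      have h2 := hB 0
      have hg := hγ 1 le_rfl
      simp only [if_true, hA0, hB0] at h1 h2
      rw [hp, hp, hz, hz]
      apply mul_left_cancel₀ hg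
      push_cast at *
      linear_combination h2 - h1
    | succ m ih =>
      obtain ⟨ih0, ih1⟩ := ih
      refine ⟨ih1, ?_⟩
      have h1 := hA (m + 1)
      have h2 := hB (m + 1)
      have hg := hγ (m + 2) (by omega)
      simp only [Nat.succ_ne_zero, if_false, Nat.add_sub_cancel] at h1 h2
      apply mul_left_cancel₀ hg
      rw [hp _ (m + 1), hp _ (m + 1)]
      have e1 := hp (c + 1) m
      have e2 := hp (c + α) m
      generalize poch (c + 1) (m + 1) = p1 at *
      generalize poch (c + α) (m + 1) = q1 at *
      generalize poch (c + 1) m = p at *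
      generalize poch (c + α) m = q at *
      push_cast at *
      linear_combination (-p1) * h1 + q1 * h2
        + (k ^ 2 * ((m : ℂ) + 1 + c + α) * ((m : ℂ) + 1 + c + β)
        + ((m : ℂ) + 1 + c) * ((m : ℂ) + 1 + c + γ - 1)
        + (1 - k ^ 2) * δ * ((m : ℂ) + 1 + c)
        - s - (α + c) * (β + c) * k ^ 2 + k ^ 2 * δ * c) * ih1
        - k ^ 2 * ((m : ℂ) + c + α) * ((m : ℂ) + c + β) * A m * e1
        + k ^ 2 * ((m : ℂ) + 1 + c) * ((m : ℂ) + c + β) * B m * e2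
        - k ^ 2 * ((m : ℂ) + c + α) * ((m : ℂ) + c + β) * ((m : ℂ) + 1 + c) * ih0
  exact fun n => (key n).1
end

section
/- Let P = {α,β;γ,δ,ε;s} be Heun parameters with modulus k, c an association parameter and μ a co-recursivity parameter, and assume that for every integer n ≥ 1 one has n+c ≠ 0, n+c+γ−1 ≠ 0 and n+c+β−1 ≠ 0. Let A : ℕ → ℂ satisfy the associated Heun recurrence with data (c,μ,P), and let B : ℕ → ℂ satisfy the associated Heun recurrence with data (c+β−1, μ, P''_β), where P''_β = {α+1−β, 2−β; γ+1−β, δ+1−β, ε+1−β; s+(β−1)(γ+δ−β)}. Then for every n ∈ ℕ, (c+1)_n A_n = (c+β)_n B_n, where (x)_n = x(x+1)⋯(x+n−1) is the Pochhammer symbol. -/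
/-- Connection between associated Heun coefficient sequences under the parameter map
`P''_β = {α+1−β, 2−β; γ+1−β, δ+1−β, ε+1−β; s+(β−1)(γ+δ−β)}` with association parameter
shifted to `c+β−1`: `(c+1)_n A_n = (c+β)_n B_n`. -/
theorem assocHeun_connection_P''_beta
    (k : ℝ) (hk0 : 0 < k ^ 2) (hk1 : k ^ 2 < 1)
    (α β γ δ ε s c μ : ℂ) (hP : α + β = γ + δ + ε - 1)
    (hc : ∀ n : ℕ, 1 ≤ n → (n : ℂ) + c ≠ 0)
    (hγ : ∀ n : ℕ, 1 ≤ n → (n : ℂ) + c + γ - 1 ≠ 0)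
    (hβ : ∀ n : ℕ, 1 ≤ n → (n : ℂ) + c + β - 1 ≠ 0)
    (A B : ℕ → ℂ)
    (hA : AssocHeunRec (k : ℂ) α β γ δ ε s c μ A)
    (hB : AssocHeunRec (k : ℂ) (α + 1 - β) (2 - β) (γ + 1 - β) (δ + 1 - β) (ε + 1 - β)
      (s + (β - 1) * (γ + δ - β)) (c + β - 1) μ B) :
    ∀ n : ℕ, poch (c + 1) n * A n = poch (c + β) n * B n := by
  have hs : ∀ (x : ℂ) (n : ℕ), poch x (n + 1) = poch x n * (x + n) := by
    intro x n
    simp [poch, Finset.prod_range_succ]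
  obtain ⟨hA0, hA⟩ := hA
  obtain ⟨hB0, hB⟩ := hB
  have h0 : poch (c + 1) 0 * A 0 = poch (c + β) 0 * B 0 := by
    simp [poch, hA0, hB0]
  have h : ∀ n : ℕ, poch (c + 1) n * A n = poch (c + β) n * B n ∧
      poch (c + 1) (n + 1) * A (n + 1) = poch (c + β) (n + 1) * B (n + 1) := by
    intro n
    induction n with
    | zero =>
      refine ⟨h0, ?_⟩
      have a := hA 0
      have b := hB 0
      have g := hγ 1 le_rfl
      simp only [if_true, Nat.cast_zero, Nat.cast_one, zero_add, hA0, hB0] at a b g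
      rw [hs, hs]
      simp only [poch, Finset.range_zero, Finset.prod_empty, Nat.cast_zero, zero_add]
      apply mul_left_cancel₀ g
      linear_combination b - a
    | succ m ih =>
      obtain ⟨h1, h2⟩ := ih
      refine ⟨h2, ?_⟩
      have a := hA (m + 1)
      have b := hB (m + 1)
      have g := hγ (m + 2) (by omega)
      simp only [Nat.succ_ne_zero, if_false, Nat.add_sub_cancel, Nat.cast_add, Nat.cast_one,
        Nat.cast_ofNat] at a b g
      rw [hs (c + 1) (m + 1), hs (c + β) (m + 1)]
      apply mul_left_cancel₀ g
      push_cast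
      have e1 := hs (c + 1) m
      have e2 := hs (c + β) m
      linear_combination poch (c + β) (m + 1) * b - poch (c + 1) (m + 1) * a
        + (k ^ 2 * ((m : ℂ) + 1 + c + α) * ((m : ℂ) + 1 + c + β)
          + ((m : ℂ) + 1 + c) * ((m : ℂ) + 1 + c + γ - 1)
          + (1 - k ^ 2) * δ * ((m : ℂ) + 1 + c)
          - s - (α + c) * (β + c) * k ^ 2 + k ^ 2 * δ * c) * h2
        - k ^ 2 * ((m : ℂ) + c + α) * ((m : ℂ) + c + β) * ((m : ℂ) + c + 1) * h1
        - k ^ 2 * ((m : ℂ) + c + α) * ((m : ℂ) + c + β) * A m * e1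
        + k ^ 2 * ((m : ℂ) + c + α) * ((m : ℂ) + c + 1) * B m * e2
  exact fun n => (h n).1
end

section
/- Let P = {α,β;γ,δ,ε;s} be Heun parameters with modulus k, c an association parameter and μ a co-recursivity parameter. Assume 1 > Re α > −Re c, and that for every integer n ≥ 1, n+c ≠ 0, n+c+γ−1 ≠ 0 and n+c+α−1 ≠ 0. Let A satisfy the associated Heun recurrence with data (c,μ,P) and B satisfy the associated Heun recurrence with data (c+α−1, μ, P''_α), where P''_α = {2−α, β+1−α; γ+1−α, δ+1−α, ε+1−α; s+(α−1)(γ+δ−α)}. Suppose the power series Hn(c,μ,P;w) = Σ_{n≥0} A_n wⁿ and Hn(c+α−1,μ,P''_α;w) = Σ_{n≥0} B_n wⁿ both converge for every complex w with |w| < 1. Then for every w with |w| < 1: Hn(c,μ,P;w) = (1/B(1−α, c+α)) ∫₀¹ t^{c+α−1} (1−t)^{−α} Hn(c+α−1,μ,P''_α; wt) dt, where B(x,y) is the Beta function and the complex powers of t ∈ (0,1) and 1−t are the principal ones. -/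
lemma beta_facts (α c : ℂ) (h1 : α.re < 1) (h2 : -c.re < α.re) (n : ℕ) :
    Complex.betaIntegral (c + α + n) (1 - α) ≠ 0 ∧
    ((n : ℂ) + 1 + c) * Complex.betaIntegral (c + α + (n + 1 : ℕ)) (1 - α)
      = ((n : ℂ) + c + α) * Complex.betaIntegral (c + α + n) (1 - α) := by
  have hn : (0 : ℝ) ≤ n := Nat.cast_nonneg n
  have r1 : 0 < (c + α + n).re := by simp; linarith
  have r1' : 0 < (c + α + (n + 1 : ℕ)).re := by simp; linarith
  have r2 : 0 < (1 - α).re := by simp; linarith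
  have r3 : 0 < ((n : ℂ) + 1 + c).re := by simp; linarith
  have e := Complex.Gamma_mul_Gamma_eq_betaIntegral r1 r2
  have e' := Complex.Gamma_mul_Gamma_eq_betaIntegral r1' r2
  have z1 : c + α + n ≠ 0 := by intro h; rw [h] at r1; simp at r1
  have z3 : (n : ℂ) + 1 + c ≠ 0 := by intro h; rw [h] at r3; simp at r3
  have s1 : c + α + (n + 1 : ℕ) = (c + α + n) + 1 := by push_cast; ring
  have s2 : c + α + n + (1 - α) = (n : ℂ) + 1 + c := by ring
  have s3 : c + α + n + 1 + (1 - α) = ((n : ℂ) + 1 + c) + 1 := by ring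
  have g1 := Complex.Gamma_ne_zero_of_re_pos r1
  have g2 := Complex.Gamma_ne_zero_of_re_pos r2
  have g3 := Complex.Gamma_ne_zero_of_re_pos r3
  rw [s1, s3, Complex.Gamma_add_one _ z1, Complex.Gamma_add_one _ z3] at e'
  rw [s2] at e
  rw [s1]
  refine ⟨fun h => ?_, ?_⟩
  · rw [h, mul_zero] at e
    exact mul_ne_zero g1 g2 e
  · apply mul_left_cancel₀ g3
    linear_combination (c + α + n) * e - e'

/-- The integral transform `Hn(c,μ,P;w) =
(1/B(1−α,c+α)) ∫₀¹ t^{c+α−1} (1−t)^{−α} Hn(c+α−1,μ,P''_α;wt) dt` on the unit disk,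
where `P''_α = {2−α, β+1−α; γ+1−α, δ+1−α, ε+1−α; s+(α−1)(γ+δ−α)}`. -/
theorem assocHeun_integral_transform_P''_alpha
    (k : ℝ) (hk0 : 0 < k ^ 2) (hk1 : k ^ 2 < 1)
    (α β γ δ ε s c μ : ℂ) (hP : α + β = γ + δ + ε - 1)
    (hre : 1 > α.re ∧ α.re > -c.re)
    (hc : ∀ n : ℕ, 1 ≤ n → (n : ℂ) + c ≠ 0)
    (hγ : ∀ n : ℕ, 1 ≤ n → (n : ℂ) + c + γ - 1 ≠ 0)
    (hα : ∀ n : ℕ, 1 ≤ n → (n : ℂ) + c + α - 1 ≠ 0)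
    (A B : ℕ → ℂ)
    (hA : AssocHeunRec (k : ℂ) α β γ δ ε s c μ A)
    (hB : AssocHeunRec (k : ℂ) (2 - α) (β + 1 - α) (γ + 1 - α) (δ + 1 - α) (ε + 1 - α)
      (s + (α - 1) * (γ + δ - α)) (c + α - 1) μ B)
    (HA HB : ℂ → ℂ)
    (hHA : ∀ w : ℂ, ‖w‖ < 1 → HasSum (fun n : ℕ => A n * w ^ n) (HA w))
    (hHB : ∀ w : ℂ, ‖w‖ < 1 → HasSum (fun n : ℕ => B n * w ^ n) (HB w)) :
    ∀ w : ℂ, ‖w‖ < 1 →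
      HA w = (1 / Complex.betaIntegral (1 - α) (c + α)) *
        ∫ t in (0 : ℝ)..1,
          (t : ℂ) ^ (c + α - 1) * (1 - (t : ℂ)) ^ (-α) * HB (w * t) := by
  have hne := fun n => (beta_facts α c hre.1 hre.2 n).1
  have hrec := fun n => (beta_facts α c hre.1 hre.2 n).2
  obtain ⟨hA0, hA⟩ := hA
  obtain ⟨hB0, hB⟩ := hB
  set I : ℕ → ℂ := fun n => Complex.betaIntegral (c + α + n) (1 - α) with hI
  have hrec' : ∀ n : ℕ, ((n : ℂ) + 1 + c) * I (n + 1) = ((n : ℂ) + c + α) * I n := hrec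
  have key : ∀ n, A n * I 0 = B n * I n ∧ A (n + 1) * I 0 = B (n + 1) * I (n + 1) := by
    intro n
    induction n with
    | zero =>
      refine ⟨by rw [hA0, hB0], ?_⟩
      have a := hA 0
      have b := hB 0
      have r := hrec' 0
      have z1 := hc 1 le_rfl
      have z2 := hγ 1 le_rfl
      simp only [if_true, hA0, hB0, Nat.cast_zero, Nat.cast_one, zero_add] at a b r z1 z2 ⊢
      apply mul_left_cancel₀ (mul_ne_zero z1 z2)
      linear_combination I 0 * b - I 0 * a - (c + γ) * B 1 * r
    | succ n ih =>
      refine ⟨ih.2, ?_⟩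
      have a := hA (n + 1)
      have b := hB (n + 1)
      have r := hrec' (n + 1)
      have r0 := hrec' n
      have z1 := hc (n + 2) (by omega)
      have z2 := hγ (n + 2) (by omega)
      obtain ⟨i0, i1⟩ := ih
      simp only [Nat.succ_ne_zero, if_false, Nat.add_sub_cancel] at a b
      push_cast at a b r r0 z1 z2
      apply mul_left_cancel₀ (mul_ne_zero z1 z2)
      linear_combination -I 0 * a
        + ((k : ℂ) ^ 2 * ((n : ℂ) + 1 + c + α) * ((n : ℂ) + 1 + c + β)
          + ((n : ℂ) + 1 + c) * ((n : ℂ) + 1 + c + γ - 1)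
          + (1 - (k : ℂ) ^ 2) * δ * ((n : ℂ) + 1 + c)
          - s - (α + c) * (β + c) * (k : ℂ) ^ 2 + (k : ℂ) ^ 2 * δ * c) * i1
        - (k : ℂ) ^ 2 * ((n : ℂ) + c + α) * ((n : ℂ) + c + β) * i0
        + I (n + 1) * b - ((n : ℂ) + 2 + c + γ - 1) * B (n + 2) * r
        + (k : ℂ) ^ 2 * ((n : ℂ) + c + β) * B n * r0
  intro w hw
  have hconv : IntervalIntegrable
      (fun t : ℝ => (t : ℂ) ^ (c + α - 1) * (1 - (t : ℂ)) ^ (-α)) MeasureTheory.volume 0 1 := by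
    have := Complex.betaIntegral_convergent (u := c + α) (v := 1 - α)
      (by simp; linarith [hre.2]) (by simp; linarith [hre.1])
    simpa [sub_sub_cancel_left] using this
  have hsumm : Summable (fun n => ‖B n * w ^ n‖) := (hHB w hw).summable.norm
  have hint : HasSum (fun n : ℕ => ∫ t in (0 : ℝ)..1,
      (t : ℂ) ^ (c + α - 1) * (1 - (t : ℂ)) ^ (-α) * (B n * (w * t) ^ n))
      (∫ t in (0 : ℝ)..1, (t : ℂ) ^ (c + α - 1) * (1 - (t : ℂ)) ^ (-α) * HB (w * t)) := by
    apply intervalIntegral.hasSum_integral_of_dominated_convergence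
      (fun n t => ‖(t : ℂ) ^ (c + α - 1) * (1 - (t : ℂ)) ^ (-α)‖ * ‖B n * w ^ n‖)
    · intro n
      have h1 := (intervalIntegrable_iff.mp hconv).aestronglyMeasurable
      refine h1.mul (Continuous.aestronglyMeasurable ?_)
      fun_prop
    · intro n
      refine Filter.Eventually.of_forall fun t ht => ?_
      rw [Set.uIoc_of_le zero_le_one] at ht
      rw [norm_mul]
      gcongr
      rw [norm_mul, norm_mul, norm_pow, norm_pow, norm_mul]
      gcongr
      rw [Complex.norm_real, Real.norm_of_nonneg ht.1.le]
      exact mul_le_of_le_one_right (norm_nonneg _) ht.2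
    · exact Filter.Eventually.of_forall fun t _ => hsumm.mul_left _
    · simp_rw [tsum_mul_left]
      exact hconv.norm.mul_const _
    · refine Filter.Eventually.of_forall fun t ht => ?_
      rw [Set.uIoc_of_le zero_le_one] at ht
      refine (hHB (w * t) ?_).mul_left _
      rw [norm_mul, Complex.norm_real, Real.norm_of_nonneg ht.1.le]
      exact (mul_le_of_le_one_right (norm_nonneg _) ht.2).trans_lt hw
  have hterm : ∀ n : ℕ, (∫ t in (0 : ℝ)..1,
      (t : ℂ) ^ (c + α - 1) * (1 - (t : ℂ)) ^ (-α) * (B n * (w * t) ^ n))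
      = I 0 * (A n * w ^ n) := by
    intro n
    have h1 : (∫ t in (0 : ℝ)..1,
      (t : ℂ) ^ (c + α - 1) * (1 - (t : ℂ)) ^ (-α) * (B n * (w * t) ^ n))
      = ∫ t in (0 : ℝ)..1, (B n * w ^ n) *
        ((t : ℂ) ^ (c + α + n - 1) * (1 - (t : ℂ)) ^ (1 - α - 1)) := by
      apply intervalIntegral.integral_congr_ae
      refine Filter.Eventually.of_forall fun t ht => ?_
      rw [Set.uIoc_of_le zero_le_one] at ht
      have ht0 : (t : ℂ) ≠ 0 := by exact_mod_cast ht.1.ne'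
      have e1 : c + α + n - 1 = (c + α - 1) + n := by ring
      have e2 : 1 - α - 1 = -α := by ring
      rw [e1, e2, Complex.cpow_add _ _ ht0, Complex.cpow_natCast, mul_pow]
      ring
    rw [h1, intervalIntegral.integral_const_mul]
    change B n * w ^ n * I n = _
    linear_combination - w ^ n * (key n).1
  simp_rw [hterm] at hint
  have := hint.unique ((hHA w hw).mul_left (I 0))
  rw [this, Complex.betaIntegral_symm]
  have hI0 : Complex.betaIntegral (c + α) (1 - α) = I 0 := by simp [hI]
  have h0 : I 0 ≠ 0 := hne 0
  rw [hI0]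
  field_simp
end

section
/- Let P = {α,β;γ,δ,ε;s} be complex parameters with α+β = γ+δ+ε−1 and γ + n ≠ 0 for every integer n ≥ 0, and let r ∈ ℂ satisfy r² − (γ−α−β)r + αβ + s = 0. Suppose the power series f(w) = Σ_{n≥0} (r+α)_n (r+β)_n / ((γ)_n · n!) · wⁿ converges for every complex w with |w| < 1, where (x)_n is the Pochhammer symbol. Then the function F(w) = (1−w)^r f(w), with the real power (1−w)^r = exp(r·log(1−w)) for real w, satisfies w(1−w)² F''(w) + [γ(1−w)² − δw(1−w) − εw(1−w)] F'(w) + (αβw + s) F(w) = 0 for every real w ∈ (0,1); that is, F solves Heun's differential equation in the degenerate case k² = 1. -/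
/-- A power series converging on the unit disc is differentiable there, and may be
differentiated term by term. -/
lemma series_deriv (c : ℕ → ℂ) (f : ℂ → ℂ)
    (hf : ∀ w : ℂ, ‖w‖ < 1 → HasSum (fun n : ℕ => c n * w ^ n) (f w)) :
    DifferentiableOn ℂ f (Metric.ball 0 1) ∧
    ∀ w : ℂ, ‖w‖ < 1 →
      HasSum (fun n : ℕ => ((n : ℂ) + 1) * c (n + 1) * w ^ n) (deriv f w) := by
  have hball : HasFPowerSeriesOnBall f (FormalMultilinearSeries.ofScalars ℂ c) 0 1 := by
    refine ⟨?_, one_pos, ?_⟩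
    · refine ENNReal.le_of_forall_nnreal_lt fun ρ hρ => ?_
      have hρ1 : (ρ : ℝ) < 1 := by exact_mod_cast hρ
      apply FormalMultilinearSeries.le_radius_of_summable
      have h := (hf (ρ : ℝ) (by simpa using hρ1)).summable.norm
      simpa [FormalMultilinearSeries.ofScalars_norm] using h
    · intro y hy
      have hy1 : ‖y‖ < 1 := by
        rw [← ENNReal.ofReal_one, Metric.eball_ofReal] at hy
        simpa using hy
      simpa [FormalMultilinearSeries.ofScalars_apply_eq, mul_comm] using hf y hy1
  have hd : DifferentiableOn ℂ f (Metric.ball 0 1) := by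
    have := hball.differentiableOn
    rwa [← ENNReal.ofReal_one, Metric.eball_ofReal] at this
  refine ⟨hd, fun w hw => ?_⟩
  have hc : ∀ n, iteratedDeriv n f 0 / n.factorial = c n := by
    have h1 := (hball.analyticAt).hasFPowerSeriesAt.eq_formalMultilinearSeries
      hball.hasFPowerSeriesAt
    intro n
    exact congrFun (FormalMultilinearSeries.ofScalars_series_injective (𝕜 := ℂ) ℂ h1) n
  have h2 := Complex.hasSum_taylorSeries_on_ball (hd.deriv Metric.isOpen_ball)
    (z := w) (by simpa using hw)
  convert! h2 using 2 with n
  rw [← iteratedDeriv_succ', ← hc (n + 1), Nat.factorial_succ]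
  have : (n.factorial : ℂ) ≠ 0 := by exact_mod_cast n.factorial_ne_zero
  have h3 : (n : ℂ) + 1 ≠ 0 := by exact_mod_cast n.succ_ne_zero
  push_cast
  simp only [smul_eq_mul, sub_zero]
  field_simp

lemma series_shift (d : ℕ → ℂ) (w S : ℂ) (h0 : d 0 = 0)
    (h : HasSum (fun n : ℕ => d (n + 1) * w ^ n) S) :
    HasSum (fun n : ℕ => d n * w ^ n) (w * S) := by
  rw [← hasSum_nat_add_iff' 1]
  simp only [Finset.range_one, Finset.sum_singleton, h0, zero_mul, sub_zero]
  convert! h.mul_left w using 2 with n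
  ring

lemma coeff_rec (a b γ : ℂ) (hγ : ∀ n : ℕ, γ + (n : ℂ) ≠ 0) (n : ℕ) :
    ((n : ℂ) + 1) * (γ + n) * (poch a (n + 1) * poch b (n + 1) /
        (poch γ (n + 1) * ((n + 1).factorial : ℂ)))
      = (a + n) * (b + n) * (poch a n * poch b n / (poch γ n * (n.factorial : ℂ))) := by
  have h1 : (n.factorial : ℂ) ≠ 0 := by exact_mod_cast n.factorial_ne_zero
  have h2 : (n : ℂ) + 1 ≠ 0 := by exact_mod_cast n.succ_ne_zero
  have h3 : poch γ n ≠ 0 := Finset.prod_ne_zero_iff.2 fun i _ => hγ i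
  have h4 := hγ n
  have hs : ∀ x, poch x (n + 1) = poch x n * (x + n) := fun x => Finset.prod_range_succ _ _
  rw [hs, hs, hs, Nat.factorial_succ]
  push_cast
  field_simp

lemma hyp_ode (a b γ : ℂ) (c : ℕ → ℂ)
    (hc : ∀ n : ℕ, ((n : ℂ) + 1) * (γ + n) * c (n + 1) = (a + n) * (b + n) * c n)
    (w S0 S1 S2 : ℂ)
    (h0 : HasSum (fun n : ℕ => c n * w ^ n) S0)
    (h1 : HasSum (fun n : ℕ => ((n : ℂ) + 1) * c (n + 1) * w ^ n) S1)
    (h2 : HasSum (fun n : ℕ => ((n : ℂ) + 1) * (((n + 1 : ℕ) : ℂ) + 1) * c (n + 2) * w ^ n) S2) :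
    w * (1 - w) * S2 + (γ - (a + b + 1) * w) * S1 - a * b * S0 = 0 := by
  have e1 := series_shift (fun n => (n : ℂ) * c n) w S1 (by simp) (by simpa using h1)
  have e2 := series_shift (fun n => (n : ℂ) * ((n : ℂ) + 1) * c (n + 1)) w S2 (by simp)
    (by simpa using h2)
  have e3 := series_shift (fun n => (n : ℂ) * ((n : ℂ) - 1) * c n) w (w * S2) (by simp) (by
    convert! e2 using 2 with n
    push_cast
    ring)
  have H := (((e2.sub e3).add (h1.mul_left γ)).sub (e1.mul_left (a + b + 1))).sub
    (h0.mul_left (a * b))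
  have hz : HasSum (fun _ : ℕ => (0 : ℂ)) 0 := hasSum_zero
  have := H.unique (by
    convert! hz using 2 with n
    linear_combination w ^ n * hc n)
  linear_combination this

/-- In the degenerate case `k² = 1`, the function `F(w) = (1−w)^r ₂F₁(r+α, r+β; γ; w)`
with `r² − (γ−α−β)r + αβ + s = 0` solves Heun's differential equation
`w(1−w)²F'' + [γ(1−w)² − δw(1−w) − εw(1−w)]F' + (αβw + s)F = 0` on `(0,1)`. -/
theorem heun_k_one_solution
    (α β γ δ ε s r : ℂ) (hP : α + β = γ + δ + ε - 1)
    (hγ : ∀ n : ℕ, γ + (n : ℂ) ≠ 0)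
    (hr : r ^ 2 - (γ - α - β) * r + α * β + s = 0)
    (f : ℂ → ℂ)
    (hf : ∀ w : ℂ, ‖w‖ < 1 →
      HasSum (fun n : ℕ =>
        poch (r + α) n * poch (r + β) n / (poch γ n * (n.factorial : ℂ)) * w ^ n) (f w))
    (F : ℝ → ℂ)
    (hF : ∀ w : ℝ, F w = Complex.exp (r * Complex.log (1 - (w : ℂ))) * f (w : ℂ)) :
    ∀ w : ℝ, 0 < w → w < 1 →
      (w : ℂ) * (1 - (w : ℂ)) ^ 2 * deriv (deriv F) w
        + (γ * (1 - (w : ℂ)) ^ 2 - δ * (w : ℂ) * (1 - (w : ℂ))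
            - ε * (w : ℂ) * (1 - (w : ℂ))) * deriv F w
        + (α * β * (w : ℂ) + s) * F w = 0 := by
  intro w hw0 hw1
  set c : ℕ → ℂ := fun n => poch (r + α) n * poch (r + β) n / (poch γ n * (n.factorial : ℂ))
    with hcdef
  obtain ⟨hd0, hs1⟩ := series_deriv c f hf
  obtain ⟨hd1, hs2⟩ := series_deriv (fun n => ((n : ℂ) + 1) * c (n + 1)) (deriv f) hs1
  have key : ∀ x : ℝ, 0 < x → x < 1 → ‖(x : ℂ)‖ < 1 := by
    intro x h0 h1
    rw [Complex.norm_real, Real.norm_eq_abs, abs_of_pos h0]; exact h1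
  have hne : ∀ x : ℝ, x < 1 → (1 - (x : ℂ)) ≠ 0 := by
    intro x h1 h
    have : ((1 - x : ℝ) : ℂ) = 0 := by push_cast; exact h
    rw [Complex.ofReal_eq_zero] at this
    linarith
  have hE : ∀ x : ℝ, x < 1 → HasDerivAt (fun z : ℂ => Complex.exp (r * Complex.log (1 - z)))
      (Complex.exp (r * Complex.log (1 - (x : ℂ))) * (r * (-1 / (1 - (x : ℂ))))) (x : ℂ) := by
    intro x h1
    have hs : (1 - (x : ℂ)) ∈ Complex.slitPlane := by
      left
      simpa using h1
    exact ((((hasDerivAt_id (x : ℂ)).const_sub 1).clog hs).const_mul r).cexp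
  have hf1 : ∀ x : ℝ, 0 < x → x < 1 → HasDerivAt f (deriv f x) (x : ℂ) := fun x h0 h1 =>
    (hd0.differentiableAt (Metric.isOpen_ball.mem_nhds (by simpa using key x h0 h1))).hasDerivAt
  have hf2 : ∀ x : ℝ, 0 < x → x < 1 → HasDerivAt (deriv f) (deriv (deriv f) x) (x : ℂ) :=
    fun x h0 h1 =>
    (hd1.differentiableAt (Metric.isOpen_ball.mem_nhds (by simpa using key x h0 h1))).hasDerivAt
  have hFeq : F = fun x : ℝ => Complex.exp (r * Complex.log (1 - (x : ℂ))) * f (x : ℂ) :=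
    funext hF
  have hF1 : ∀ x : ℝ, 0 < x → x < 1 → deriv F x =
      Complex.exp (r * Complex.log (1 - (x : ℂ))) * (r * (-1 / (1 - (x : ℂ)))) * f x
      + Complex.exp (r * Complex.log (1 - (x : ℂ))) * deriv f x := by
    intro x h0 h1
    rw [hFeq]
    exact ((hE x h1).mul (hf1 x h0 h1)).comp_ofReal.deriv
  have hF2 : deriv (deriv F) w =
      (Complex.exp (r * Complex.log (1 - (w : ℂ))) * (r * (-1 / (1 - (w : ℂ))))
          * (r * (-1 / (1 - (w : ℂ))))
        + Complex.exp (r * Complex.log (1 - (w : ℂ))) * (r * (-1 / (1 - (w : ℂ)) ^ 2))) * f w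
      + Complex.exp (r * Complex.log (1 - (w : ℂ))) * (r * (-1 / (1 - (w : ℂ)))) * deriv f w
      + (Complex.exp (r * Complex.log (1 - (w : ℂ))) * (r * (-1 / (1 - (w : ℂ)))) * deriv f w
        + Complex.exp (r * Complex.log (1 - (w : ℂ))) * deriv (deriv f) w) := by
    have hev : deriv F =ᶠ[nhds w] fun x : ℝ =>
        Complex.exp (r * Complex.log (1 - (x : ℂ))) * (r * (-1 / (1 - (x : ℂ)))) * f x
        + Complex.exp (r * Complex.log (1 - (x : ℂ))) * deriv f x := by
      filter_upwards [Ioo_mem_nhds hw0 hw1] with x hx using hF1 x hx.1 hx.2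
    rw [hev.deriv_eq]
    have hq : HasDerivAt (fun z : ℂ => r * (-1 / (1 - z)))
        (r * (-1 / (1 - (w : ℂ)) ^ 2)) (w : ℂ) := by
      have := (((hasDerivAt_const (w : ℂ) (-1 : ℂ)).fun_div
        ((hasDerivAt_id (w : ℂ)).const_sub 1) (hne w hw1))).const_mul r
      convert! this using 1
      simp
    exact ((((hE w hw1).mul hq).mul (hf1 w hw0 hw1)).add
      ((hE w hw1).mul (hf2 w hw0 hw1))).comp_ofReal.deriv
  have ode := hyp_ode (r + α) (r + β) γ c (coeff_rec (r + α) (r + β) γ hγ) w (f w) (deriv f w)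
    (deriv (deriv f) w) (hf w (key w hw0 hw1)) (hs1 w (key w hw0 hw1)) (by
      convert! hs2 w (key w hw0 hw1) using 2 with n
      ring)
  rw [hF2, hF1 w hw0 hw1, hF w]
  have hn := hne w hw1
  generalize Complex.exp (r * Complex.log (1 - (w : ℂ))) = E
  generalize deriv (deriv f) (w : ℂ) = f2 at *
  generalize deriv f (w : ℂ) = f1 at *
  generalize f (w : ℂ) = f0 at *
  have hδ : δ = α + β - γ - ε + 1 := by linear_combination -hP
  have hs : s = -(r ^ 2 - (γ - α - β) * r + α * β) := by linear_combination hr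
  subst hδ hs
  generalize (w : ℂ) = z at *
  field_simp
  linear_combination (1 - z) * E * ode
end
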